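/- arXiv:math-ph/0604027 — 3 statements merged into one kernel-verified Lean document; each statement's English description precedes it below -/
import Mathlib

section
/- Let Q : ℝ → ℝ be continuous and suppose Q is integrable on (c, ∞) for every real c. Let u, q : ℝ → ℝ be differentiable functions satisfying, for all s ∈ ℝ, u′(s) = −Q(s)·q(s) and q′(s) = Q(s)·(1 − u(s)), and suppose u(s) → 0 and q(s) → 1 as s → ∞. Then for every s ∈ ℝ, q(s) = exp(−∫_s^∞ Q(t) dt) and u(s) = 1 − exp(−∫_s^∞ Q(t) dt). -/
open MeasureTheory Filter

lemma scalar_aux (Q f : ℝ → ℝ) (k L : ℝ) (hQc : Continuous Q)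
    (hQi : ∀ c : ℝ, IntegrableOn Q (Set.Ioi c))
    (hf : ∀ s, HasDerivAt f (k * Q s * f s) s)
    (hL : Tendsto f atTop (nhds L)) (s : ℝ) :
    f s = L * Real.exp (-k * ∫ t in Set.Ioi s, Q t) := by
  have hG : ∀ x, HasDerivAt (fun x => f x * Real.exp (-k * ∫ t in s..x, Q t)) 0 x := by
    intro x
    have h1 : HasDerivAt (fun x => ∫ t in s..x, Q t) (Q x) x :=
      intervalIntegral.integral_hasDerivAt_right (hQc.intervalIntegrable _ _)
        (hQc.stronglyMeasurableAtFilter _ _) hQc.continuousAt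
    have h2 := (hf x).mul ((h1.const_mul (-k)).exp)
    refine HasDerivAt.congr_deriv h2 ?_
    ring
  have hconst : ∀ x, f x * Real.exp (-k * ∫ t in s..x, Q t) = f s := by
    intro x
    have := is_const_of_deriv_eq_zero (fun x => (hG x).differentiableAt)
      (fun x => (hG x).deriv) x s
    simpa using this
  have hlim := hL.mul ((Real.continuous_exp.tendsto _).comp
    ((intervalIntegral_tendsto_integral_Ioi s (hQi s) tendsto_id).const_mul (-k)))
  refine tendsto_nhds_unique (tendsto_const_nhds (x := f s) (f := atTop (α := ℝ))) ?_
  refine hlim.congr ?_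
  intro x
  simpa using hconst x


/-- The coupled first-order system `u′ = −Q·q`, `q′ = Q·(1 − u)` with boundary
conditions `u → 0`, `q → 1` at `+∞` has solution `u = 1 − exp(−∫_s^∞ Q)`,
`q = exp(−∫_s^∞ Q)`. -/
theorem ode_system_solution
    (Q u q : ℝ → ℝ) (hQc : Continuous Q)
    (hQi : ∀ c : ℝ, IntegrableOn Q (Set.Ioi c))
    (hu : Differentiable ℝ u) (hq : Differentiable ℝ q)
    (hu' : ∀ s : ℝ, deriv u s = -Q s * q s)
    (hq' : ∀ s : ℝ, deriv q s = Q s * (1 - u s))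
    (hu0 : Tendsto u atTop (nhds 0))
    (hq1 : Tendsto q atTop (nhds 1)) :
    ∀ s : ℝ,
      q s = Real.exp (-∫ t in Set.Ioi s, Q t) ∧
      u s = 1 - Real.exp (-∫ t in Set.Ioi s, Q t) := by
  intro s
  have du : ∀ s, HasDerivAt u (-Q s * q s) s := fun s => hu' s ▸ (hu s).hasDerivAt
  have dq : ∀ s, HasDerivAt q (Q s * (1 - u s)) s := fun s => hq' s ▸ (hq s).hasDerivAt
  have ha := scalar_aux Q (fun s => q s + (1 - u s)) 1 (1 + (1 - 0)) hQc hQi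
    (fun s => by
      refine HasDerivAt.congr_deriv ((dq s).add ((du s).const_sub 1)) ?_
      ring) (hq1.add (hu0.const_sub 1)) s
  have hb := scalar_aux Q (fun s => q s - (1 - u s)) (-1) (1 - (1 - 0)) hQc hQi
    (fun s => by
      refine HasDerivAt.congr_deriv ((dq s).sub ((du s).const_sub 1)) ?_
      ring) (hq1.sub (hu0.const_sub 1)) s
  simp only [neg_mul, one_mul, sub_zero, sub_self, zero_mul] at ha hb
  constructor <;> linarith
end

section
/- For every real number a ≥ 0 and all reals s > 0, x > 0, t > 0, the function s ↦ (√s/2)·J_a(√(s·x·t)) is differentiable, the function x ↦ (√s/2)·J_a(√(s·x·t)) is differentiable, and 2s · (∂/∂s)[(√s/2)·J_a(√(s·x·t))] = (√s/2)·J_a(√(s·x·t)) + 2x · (∂/∂x)[(√s/2)·J_a(√(s·x·t))]. -/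
open MeasureTheory

/-- The Bessel function of the first kind of order `a`, defined by its power
series; the power `(x/2)^(2k+a)` is the real power, with `(0:ℝ)^(0:ℝ) = 1`. -/
noncomputable def besselJ (a x : ℝ) : ℝ :=
  ∑' k : ℕ, ((-1 : ℝ) ^ k / (Nat.factorial k * Real.Gamma (k + a + 1))) *
    (x / 2) ^ (2 * (k : ℝ) + a)

theorem bes_gamma_le (a : ℝ) (ha : 0 ≤ a) (k : ℕ) :
    Real.Gamma (a + 1) ≤ Real.Gamma (k + a + 1) := by
  induction k with
  | zero => simp
  | succ k ih =>
    have hk : (0:ℝ) ≤ k := Nat.cast_nonneg k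
    have h0 : (k:ℝ) + a + 1 ≠ 0 := by positivity
    have hpos : 0 < Real.Gamma (k + a + 1) := Real.Gamma_pos_of_pos (by positivity)
    have e : ((k + 1 : ℕ) : ℝ) + a + 1 = (k + a + 1) + 1 := by push_cast; ring
    rw [e, Real.Gamma_add_one h0]
    nlinarith [mul_nonneg (add_nonneg hk ha) hpos.le]

theorem bes_coef_le (a : ℝ) (ha : 0 ≤ a) (k : ℕ) :
    |(-1 : ℝ) ^ k / (Nat.factorial k * Real.Gamma (k + a + 1))| ≤
      (1 / Real.Gamma (a + 1)) * (1 / Nat.factorial k) := by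
  have hG : 0 < Real.Gamma (a + 1) := Real.Gamma_pos_of_pos (by positivity)
  have h := bes_gamma_le a ha k
  have hG' : 0 < Real.Gamma (k + a + 1) := hG.trans_le h
  have hf : (0:ℝ) < Nat.factorial k := by exact_mod_cast Nat.factorial_pos k
  rw [abs_div, abs_pow, abs_neg, abs_one, one_pow, abs_of_pos (mul_pos hf hG'),
    one_div_mul_one_div]
  apply one_div_le_one_div_of_le (mul_pos hG hf)
  rw [mul_comm]
  exact mul_le_mul_of_nonneg_left h hf.le

theorem bes_series_diff (c : ℕ → ℝ) (C : ℝ) (hC : 0 ≤ C)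
    (hc : ∀ k, |c k| ≤ C * (1 / Nat.factorial k)) (z : ℝ) :
    DifferentiableAt ℝ (fun z : ℝ => ∑' k, c k * z ^ k) z := by
  set R : ℝ := |z| + 1 with hR
  have hR1 : 1 ≤ R := by have := abs_nonneg z; linarith
  have hu : Summable (fun k : ℕ => C * ((2 * R) ^ k / Nat.factorial k)) :=
    (Real.summable_pow_div_factorial (2 * R)).mul_left C
  refine (hasDerivAt_tsum_of_isPreconnected (t := Metric.ball (0:ℝ) R)
    (g := fun k z => c k * z ^ k) (g' := fun k z => c k * (k * z ^ (k - 1))) hu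
    Metric.isOpen_ball (convex_ball (0:ℝ) R).isPreconnected
    (fun k y _ => (hasDerivAt_pow k y).const_mul (c k)) ?_ (y₀ := 0) ?_ ?_ (y := z) ?_).differentiableAt
  · intro k y hy
    have hy' : |y| ≤ R := by
      have := mem_ball_zero_iff.1 hy
      rw [Real.norm_eq_abs] at this; exact this.le
    have h1 : |(k:ℝ) * y ^ (k - 1)| ≤ (2 * R) ^ k := by
      rw [abs_mul, abs_pow, Nat.abs_cast, mul_pow]
      have h2 : (k:ℝ) ≤ 2 ^ k := by exact_mod_cast (Nat.lt_two_pow_self (n := k)).le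
      have h3 : |y| ^ (k - 1) ≤ R ^ k :=
        (pow_le_pow_left₀ (abs_nonneg y) hy' _).trans (pow_le_pow_right₀ hR1 (Nat.sub_le k 1))
      exact mul_le_mul h2 h3 (by positivity) (by positivity)
    rw [Real.norm_eq_abs, abs_mul]
    calc _ ≤ (C * (1 / Nat.factorial k)) * (2 * R) ^ k :=
          mul_le_mul (hc k) h1 (abs_nonneg _) (by positivity)
      _ = _ := by ring
  · exact Metric.mem_ball_self (by linarith)
  · apply summable_of_ne_finset_zero (s := {0})
    intro k hk
    have : k ≠ 0 := by simpa using hk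
    simp [this]
  · rw [mem_ball_zero_iff, Real.norm_eq_abs]; linarith

theorem bes_diff (a : ℝ) (ha : 0 ≤ a) (y : ℝ) (hy : 0 < y) :
    DifferentiableAt ℝ (besselJ a) y := by
  have hG : 0 < Real.Gamma (a + 1) := Real.Gamma_pos_of_pos (by positivity)
  have hF := bes_series_diff
    (fun k => (-1 : ℝ) ^ k / (Nat.factorial k * Real.Gamma (k + a + 1)))
    (1 / Real.Gamma (a + 1)) (by positivity) (bes_coef_le a ha) ((y / 2) ^ 2)
  have h1 : DifferentiableAt ℝ (fun y : ℝ => (y / 2) ^ 2) y := by fun_prop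
  have h2 : DifferentiableAt ℝ (fun y : ℝ => (y / 2) ^ a) y :=
    DifferentiableAt.rpow_const (by fun_prop) (Or.inl (by positivity))
  have h3 := h2.mul (DifferentiableAt.comp y hF h1)
  refine h3.congr_of_eventuallyEq ?_
  filter_upwards [lt_mem_nhds hy] with w hw
  have hw2 : 0 < w / 2 := by positivity
  simp only [besselJ, Pi.mul_apply, Function.comp]
  rw [← tsum_mul_left]
  refine tsum_congr fun k => ?_
  rw [Real.rpow_add hw2, ← pow_mul]
  have : (w / 2) ^ (2 * (k:ℝ)) = (w / 2) ^ (2 * k) := by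
    rw [← Real.rpow_natCast]; push_cast; rfl
  rw [this]; ring

/-- The relation `2s ∂_s V = (I + 2Δ) V` at the level of the hard-edge kernel
`V(x,t) = (√s/2) J_a(√(sxt))`: both partial derivatives exist and
`2s ∂_s[(√s/2)J_a(√(sxt))] = (√s/2)J_a(√(sxt)) + 2x ∂_x[(√s/2)J_a(√(sxt))]`. -/
theorem hard_edge_kernel_scaling (a : ℝ) (ha : 0 ≤ a)
    (s x t : ℝ) (hs : 0 < s) (hx : 0 < x) (ht : 0 < t) :
    DifferentiableAt ℝ
      (fun s' : ℝ => Real.sqrt s' / 2 * besselJ a (Real.sqrt (s' * x * t))) s ∧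
    DifferentiableAt ℝ
      (fun x' : ℝ => Real.sqrt s / 2 * besselJ a (Real.sqrt (s * x' * t))) x ∧
    2 * s *
        deriv (fun s' : ℝ =>
          Real.sqrt s' / 2 * besselJ a (Real.sqrt (s' * x * t))) s =
      Real.sqrt s / 2 * besselJ a (Real.sqrt (s * x * t)) +
        2 * x *
          deriv (fun x' : ℝ =>
            Real.sqrt s / 2 * besselJ a (Real.sqrt (s * x' * t))) x := by
  have hp : 0 < s * x * t := by positivity
  have hJ := (bes_diff a ha (Real.sqrt (s * x * t)) (Real.sqrt_pos.2 hp)).hasDerivAt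
  set D := deriv (besselJ a) (Real.sqrt (s * x * t))
  have l1 : HasDerivAt (fun s' : ℝ => s' * x * t) (1 * x * t) s :=
    ((hasDerivAt_id s).mul_const x).mul_const t
  have l2 : HasDerivAt (fun x' : ℝ => s * x' * t) (s * 1 * t) x :=
    ((hasDerivAt_id x).const_mul s).mul_const t
  have d1 := (((hasDerivAt_id s).sqrt hs.ne').div_const 2).mul
    (HasDerivAt.comp s hJ (l1.sqrt hp.ne'))
  have d2 := (HasDerivAt.comp x hJ (l2.sqrt hp.ne')).const_mul (Real.sqrt s / 2)
  have e1 : HasDerivAt (fun s' : ℝ => Real.sqrt s' / 2 * besselJ a (Real.sqrt (s' * x * t))) _ s := d1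
  have e2 : HasDerivAt (fun x' : ℝ => Real.sqrt s / 2 * besselJ a (Real.sqrt (s * x' * t))) _ x := d2
  refine ⟨e1.differentiableAt, e2.differentiableAt, ?_⟩
  rw [e1.deriv, e2.deriv]
  have hq : 0 < Real.sqrt (s * x * t) := Real.sqrt_pos.2 hp
  have hr : 0 < Real.sqrt s := Real.sqrt_pos.2 hs
  have hss : Real.sqrt s * Real.sqrt s = s := Real.mul_self_sqrt hs.le
  simp only [id, Function.comp]
  have k1 : s * (1 / (2 * Real.sqrt s)) = Real.sqrt s / 2 := by
    field_simp; linarith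
  linear_combination (besselJ a (Real.sqrt (s * x * t))) * k1
end

section
/- Let A be a complete normed (Banach) algebra with unit 1, and let V, O, P ∈ A satisfy ‖V‖ < 1 and O·V = −V·O − P. Then 1 − V², 1 + V are invertible, the double series ∑_{n=1}^∞ (−1)^n ∑_{k=0}^{n−1} V^k · O · V^{n−k} converges absolutely in A, and its sum equals (1 − V²)^{−1}·V·O + (1 − V²)^{−1}·P·(1 + V)^{−1}. -/
/-- The Ferrari–Spohn operator identity: in a unital Banach algebra, if
`‖V‖ < 1` and `O·V = −V·O − P`, then `1 − V²` and `1 + V` are invertible, the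
double series `∑_{n≥1} (−1)ⁿ ∑_{k=0}^{n−1} Vᵏ O V^{n−k}` converges absolutely,
and its sum equals `(1 − V²)⁻¹ V O + (1 − V²)⁻¹ P (1 + V)⁻¹`. -/
theorem ferrari_spohn_identity {A : Type*} [NormedRing A] [CompleteSpace A]
    (V O P : A) (hV : ‖V‖ < 1) (hOV : O * V = -(V * O) - P) :
    IsUnit (1 - V ^ 2) ∧ IsUnit (1 + V) ∧
    Summable (fun n : ℕ =>
      ∑ k ∈ Finset.range (n + 1), ‖V ^ k * O * V ^ (n + 1 - k)‖) ∧
    ∑' n : ℕ,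
        (-1 : A) ^ (n + 1) *
          ∑ k ∈ Finset.range (n + 1), V ^ k * O * V ^ (n + 1 - k) =
      Ring.inverse (1 - V ^ 2) * V * O +
        Ring.inverse (1 - V ^ 2) * P * Ring.inverse (1 + V) := by
  have hV' : ‖-V‖ < 1 := by rwa [norm_neg]
  have hu : IsUnit (1 + V) := by
    have := isUnit_one_sub_of_norm_lt_one hV'
    rwa [sub_neg_eq_add] at this
  have hu' : IsUnit (1 - V) := isUnit_one_sub_of_norm_lt_one hV
  have hfac : 1 - V ^ 2 = (1 - V) * (1 + V) := by noncomm_ring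
  have hfac' : 1 - V ^ 2 = (1 + V) * (1 - V) := by noncomm_ring
  have hu2 : IsUnit (1 - V ^ 2) := by rw [hfac]; exact hu'.mul hu
  have hf : Summable (fun n : ℕ => ‖(-V) ^ n‖) := summable_norm_geometric_of_norm_lt_one hV'
  have hg : Summable (fun n : ℕ => ‖O * -V * (-V) ^ n‖) :=
    Summable.of_nonneg_of_le (fun _ => norm_nonneg _) (fun n => norm_mul_le _ _)
      (hf.mul_left ‖O * -V‖)
  have hterm : ∀ n k : ℕ, k ∈ Finset.range (n + 1) →
      (-V) ^ k * (O * -V * (-V) ^ (n - k)) = (-1 : A) ^ (n + 1) * (V ^ k * O * V ^ (n + 1 - k)) := by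
    intro n k hk
    obtain ⟨j, rfl⟩ := Nat.exists_eq_add_of_le (Nat.lt_succ_iff.mp (Finset.mem_range.mp hk))
    have e1 : k + j - k = j := by omega
    have e2 : k + j + 1 - k = j + 1 := by omega
    rw [e1, e2, mul_assoc O, ← pow_succ', neg_pow V k, neg_pow V (j + 1), add_assoc k j 1,
      pow_add (-1 : A) k]
    have c : ∀ x : A, x * (-1 : A) ^ (j + 1) = (-1 : A) ^ (j + 1) * x := fun x =>
      ((Commute.neg_one_right x).pow_right (j + 1)).eq
    simp only [← mul_assoc]
    rw [mul_assoc _ O, c O, ← mul_assoc, mul_assoc _ (V ^ k), c (V ^ k)]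
    simp only [← mul_assoc]
  have hnorm : ∀ n k : ℕ, ∀ x : A, ‖(-1 : A) ^ n * x‖ = ‖x‖ := by
    intro n k x
    rcases neg_one_pow_eq_or A n with h | h <;> simp [h]
  refine ⟨hu2, hu, ?_, ?_⟩
  · have hs := summable_norm_sum_mul_range_of_summable_norm
      (f := fun n : ℕ => ‖(-V) ^ n‖) (g := fun n : ℕ => ‖O * -V * (-V) ^ n‖)
      (by simpa using hf) (by simpa using hg)
    refine Summable.of_nonneg_of_le (fun _ => Finset.sum_nonneg fun _ _ => norm_nonneg _)
      (fun n => ?_) hs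
    refine le_trans ?_ (le_abs_self _)
    refine Finset.sum_le_sum fun k hk => ?_
    rw [← hnorm (n + 1) 0, ← hterm n k hk]
    exact norm_mul_le _ _
  · have hc := tsum_mul_tsum_eq_tsum_sum_range_of_summable_norm hf hg
    have e : ∀ n : ℕ, (-1 : A) ^ (n + 1) *
          ∑ k ∈ Finset.range (n + 1), V ^ k * O * V ^ (n + 1 - k) =
        ∑ k ∈ Finset.range (n + 1), (-V) ^ k * (O * -V * (-V) ^ (n - k)) := by
      intro n
      rw [Finset.mul_sum]
      exact Finset.sum_congr rfl fun k hk => (hterm n k hk).symm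
    simp_rw [e]
    rw [← hc, hf.of_norm.tsum_mul_left]
    set G := ∑' n : ℕ, (-V) ^ n with hG
    have hG1 : G * (1 + V) = 1 := by
      have := geom_series_mul_neg (-V) hV'
      rwa [sub_neg_eq_add] at this
    have hG2 : (1 + V) * G = 1 := by
      have := mul_neg_geom_series (-V) hV'
      rwa [sub_neg_eq_add] at this
    have hGi : Ring.inverse (1 + V) = G := by
      have h := Ring.inverse_mul_cancel _ hu
      calc Ring.inverse (1 + V) = Ring.inverse (1 + V) * ((1 + V) * G) := by rw [hG2, mul_one]
        _ = G := by rw [← mul_assoc, h, one_mul]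
    rw [hGi]
    apply hu2.mul_left_cancel
    apply hu.mul_right_cancel
    have hR := Ring.mul_inverse_cancel _ hu2
    have hP : P = -(V * O) - O * V := by rw [hOV]; abel
    calc (1 - V ^ 2) * (G * (O * -V * G)) * (1 + V)
        = (1 - V) * ((1 + V) * G) * (O * -V) * (G * (1 + V)) := by
          rw [hfac]; simp only [mul_assoc]
      _ = V * O * (1 + V) + P := by rw [hG1, hG2, hP]; noncomm_ring
      _ = ((1 - V ^ 2) * Ring.inverse (1 - V ^ 2)) * V * O * (1 + V) +
          ((1 - V ^ 2) * Ring.inverse (1 - V ^ 2)) * P * (G * (1 + V)) := by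
          rw [hR, hG1]; simp
      _ = _ := by simp only [mul_add, add_mul, mul_assoc]; abel
end
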